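/- arXiv:0812.3201 — 3 statements merged into one kernel-verified Lean document; each statement's English description precedes it below -/
import Mathlib

section
/- Let Â : Ω → Finset (Fin p) be a random finset, let S : Finset (Fin p) with r ≤ S.card, and let d ∈ ℕ. Suppose that μ-almost surely (Â(ω) ∩ S).card ≤ d, and that the map T ↦ μ{ω : T ⊆ Â(ω)} is constant on the r-element subsets of S (i.e., for all T, T' ∈ S.powersetCard r, μ{T ⊆ Â} = μ{T' ⊆ Â}). Then for every T ∈ S.powersetCard r, μ{ω : T ⊆ Â(ω)} ≤ (d.choose r : ℝ) / (S.card.choose r : ℝ). -/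
open MeasureTheory

/-- The discrete σ-algebra on finsets of indices. -/
instance finsetFinMeasurableSpace (p : ℕ) : MeasurableSpace (Finset (Fin p)) := ⊤

/-- If a random finset almost surely has at most `d` elements in `S`, then the probabilities of
containing each `r`-element subset of `S` sum to at most `d.choose r`. -/
theorem sum_measure_powersetCard_subset_le {Ω α : Type*} [MeasurableSpace Ω] [DecidableEq α]
    (μ : Measure Ω) [IsProbabilityMeasure μ] (A : Ω → Finset α) (S : Finset α) (d r : ℕ)
    (hA : ∀ T ∈ S.powersetCard r, MeasurableSet {ω | T ⊆ A ω})
    (hcard : ∀ᵐ ω ∂μ, (A ω ∩ S).card ≤ d) :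
    ∑ T ∈ S.powersetCard r, μ {ω | T ⊆ A ω} ≤ d.choose r := by
  calc ∑ T ∈ S.powersetCard r, μ {ω | T ⊆ A ω}
      = ∑ T ∈ S.powersetCard r, ∫⁻ ω, {ω | T ⊆ A ω}.indicator 1 ω ∂μ :=
        Finset.sum_congr rfl fun T hT => (lintegral_indicator_one (hA T hT)).symm
    _ = ∫⁻ ω, ∑ T ∈ S.powersetCard r, {ω | T ⊆ A ω}.indicator 1 ω ∂μ :=
        (lintegral_finsetSum' _ fun T hT =>
          (measurable_one.indicator (hA T hT)).aemeasurable).symm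
    _ ≤ ∫⁻ _, (d.choose r : ENNReal) ∂μ := by
        refine lintegral_mono_ae (hcard.mono fun ω hω => ?_)
        have hfilter : (S.powersetCard r).filter (· ⊆ A ω) = (A ω ∩ S).powersetCard r := by
          ext T
          simp only [Finset.mem_filter, Finset.mem_powersetCard, Finset.subset_inter_iff]
          tauto
        simp only [Set.indicator_apply, Set.mem_ofPred_eq, Pi.one_apply, Finset.sum_boole,
          hfilter, Finset.card_powersetCard]
        exact_mod_cast Nat.choose_le_choose r hω
    _ = d.choose r := by simp

/-- Under exchangeability (the probability of recruiting an `r`-element subset of `S`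
does not depend on the subset) and the almost-sure bound `|Â ∩ S| ≤ d`, the probability
that any given `r`-element subset `T` of `S` is recruited is at most
`(d.choose r) / (S.card.choose r)`. -/
theorem sis_exchangeable_bound {Ω : Type*} [MeasurableSpace Ω] (μ : Measure Ω)
    [IsProbabilityMeasure μ] {p : ℕ} (A : Ω → Finset (Fin p)) (hA : Measurable A)
    (S : Finset (Fin p)) (d r : ℕ) (hr : r ≤ S.card)
    (hcard : ∀ᵐ ω ∂μ, ((A ω) ∩ S).card ≤ d)
    (hexch : ∀ T ∈ S.powersetCard r, ∀ T' ∈ S.powersetCard r,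
      μ {ω | T ⊆ A ω} = μ {ω | T' ⊆ A ω}) :
    ∀ T ∈ S.powersetCard r,
      (μ {ω | T ⊆ A ω}).toReal ≤ (d.choose r : ℝ) / (S.card.choose r : ℝ) := by
  intro T hT
  have hmeas : ∀ U ∈ S.powersetCard r, MeasurableSet {ω | U ⊆ A ω} := fun U _ =>
    hA (t := {B | U ⊆ B}) MeasurableSpace.measurableSet_top
  have hsum := sum_measure_powersetCard_subset_le μ A S d r hmeas hcard
  rw [Finset.sum_congr rfl fun U hU => hexch U hU T hT, Finset.sum_const,
    Finset.card_powersetCard, nsmul_eq_mul] at hsum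
  have hreal := ENNReal.toReal_mono (ENNReal.natCast_ne_top _) hsum
  rw [ENNReal.toReal_mul, ENNReal.toReal_natCast, ENNReal.toReal_natCast] at hreal
  rw [le_div_iff₀' (by exact_mod_cast Nat.choose_pos hr)]
  exact hreal
end

section
/- Let 𝒜 ⊆ Fin p be a set of active indices with complement 𝒜ᶜ (as a Finset of cardinality p − |𝒜|), let d, r ∈ ℕ with r ≤ p − |𝒜|, and let Â⁽¹⁾, Â⁽²⁾ : Ω → Finset (Fin p) be independent random finsets with the same distribution. Suppose: (i) μ-almost surely (Â⁽¹⁾(ω) ∩ 𝒜ᶜ).card ≤ d; (ii) the map T ↦ μ{ω : T ⊆ Â⁽¹⁾(ω)} is constant on the r-element subsets of 𝒜ᶜ. Then, with Â = Â⁽¹⁾ ∩ Â⁽²⁾, μ{ω : r ≤ (Â⁽¹⁾(ω) ∩ Â⁽²⁾(ω) ∩ 𝒜ᶜ).card} ≤ (d.choose r : ℝ)² / ((p − |𝒜|).choose r : ℝ). -/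
open MeasureTheory ProbabilityTheory

theorem measurableSet_setOf_subset_apply {Ω : Type*} [MeasurableSpace Ω] {p : ℕ}
    {A : Ω → Finset (Fin p)} (hA : Measurable A) (T : Finset (Fin p)) :
    MeasurableSet {ω | T ⊆ A ω} :=
  hA (t := {s | T ⊆ s}) trivial

/-- The expected number of `r`-element subsets of `B` recruited by a random finset that contains
at most `d` elements of `B` is at most `d.choose r`. -/
theorem sum_measureReal_subset_le_choose {Ω : Type*} [MeasurableSpace Ω] (μ : Measure Ω)
    [IsProbabilityMeasure μ] {p : ℕ} (B : Finset (Fin p)) (d r : ℕ)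
    {A : Ω → Finset (Fin p)} (hA : Measurable A) (hcard : ∀ᵐ ω ∂μ, (A ω ∩ B).card ≤ d) :
    ∑ T ∈ B.powersetCard r, μ.real {ω | T ⊆ A ω} ≤ (d.choose r : ℝ) := by
  have hint (T : Finset (Fin p)) :
      Integrable ({ω | T ⊆ A ω}.indicator (1 : Ω → ℝ)) μ :=
    (integrable_const (1 : ℝ)).indicator (measurableSet_setOf_subset_apply hA T)
  have hcount (ω : Ω) : ∑ T ∈ B.powersetCard r, {ω | T ⊆ A ω}.indicator (1 : Ω → ℝ) ω
      = ((A ω ∩ B).card.choose r : ℝ) := by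
    have hfilter : (B.powersetCard r).filter (· ⊆ A ω) = (A ω ∩ B).powersetCard r := by
      ext T
      simp only [Finset.mem_filter, Finset.mem_powersetCard, Finset.subset_inter_iff]
      tauto
    rw [← Finset.card_powersetCard, ← hfilter, Finset.card_filter]
    simp [Set.indicator_apply]
  calc ∑ T ∈ B.powersetCard r, μ.real {ω | T ⊆ A ω}
      = ∑ T ∈ B.powersetCard r, ∫ ω, {ω | T ⊆ A ω}.indicator (1 : Ω → ℝ) ω ∂μ :=
        Finset.sum_congr rfl fun T _ =>
          (integral_indicator_one (measurableSet_setOf_subset_apply hA T)).symm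
    _ = ∫ ω, ∑ T ∈ B.powersetCard r, {ω | T ⊆ A ω}.indicator (1 : Ω → ℝ) ω ∂μ :=
        (integral_finsetSum _ fun T _ => hint T).symm
    _ ≤ ∫ _, (d.choose r : ℝ) ∂μ := by
        refine integral_mono_ae (integrable_finsetSum _ fun T _ => hint T)
          (integrable_const _) ?_
        filter_upwards [hcard] with ω hω
        rw [hcount]
        exact_mod_cast Nat.choose_le_choose r hω
    _ = d.choose r := by simp

/-- A union bound over the `r`-element subsets of `B` recruited by both random finsets. -/
theorem measureReal_le_card_inter_le_sum_sq {Ω : Type*} [MeasurableSpace Ω] (μ : Measure Ω)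
    [IsProbabilityMeasure μ] {p : ℕ} (B : Finset (Fin p)) (r : ℕ)
    {A₁ A₂ : Ω → Finset (Fin p)} (hA₁ : Measurable A₁) (hA₂ : Measurable A₂)
    (hindep : IndepFun A₁ A₂ μ) (hident : Measure.map A₁ μ = Measure.map A₂ μ) :
    μ.real {ω | r ≤ (A₁ ω ∩ A₂ ω ∩ B).card}
      ≤ ∑ T ∈ B.powersetCard r, μ.real {ω | T ⊆ A₁ ω} ^ 2 := by
  have hcover : {ω | r ≤ (A₁ ω ∩ A₂ ω ∩ B).card}
      ⊆ ⋃ T ∈ B.powersetCard r, {ω | T ⊆ A₁ ω} ∩ {ω | T ⊆ A₂ ω} := by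
    intro ω hω
    obtain ⟨T, hT, hTcard⟩ := Finset.exists_subset_card_eq (show r ≤ _ from hω)
    simp only [Finset.subset_inter_iff] at hT
    simp only [Set.mem_iUnion]
    exact ⟨T, Finset.mem_powersetCard.2 ⟨hT.2, hTcard⟩, hT.1⟩
  have hsq (T : Finset (Fin p)) :
      μ.real ({ω | T ⊆ A₁ ω} ∩ {ω | T ⊆ A₂ ω}) = μ.real {ω | T ⊆ A₁ ω} ^ 2 := by
    have hT : MeasurableSet {s : Finset (Fin p) | T ⊆ s} := trivial
    have heq : μ {ω | T ⊆ A₁ ω} = μ {ω | T ⊆ A₂ ω} := by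
      have h : Measure.map A₁ μ {s | T ⊆ s} = Measure.map A₂ μ {s | T ⊆ s} := by rw [hident]
      rwa [Measure.map_apply hA₁ hT, Measure.map_apply hA₂ hT] at h
    have hmul : μ ({ω | T ⊆ A₁ ω} ∩ {ω | T ⊆ A₂ ω})
        = μ {ω | T ⊆ A₁ ω} * μ {ω | T ⊆ A₂ ω} :=
      hindep.measure_inter_preimage_eq_mul _ _ hT hT
    rw [measureReal_def, hmul, ← heq, ENNReal.toReal_mul, measureReal_def, sq]
  calc μ.real {ω | r ≤ (A₁ ω ∩ A₂ ω ∩ B).card}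
      ≤ μ.real (⋃ T ∈ B.powersetCard r, {ω | T ⊆ A₁ ω} ∩ {ω | T ⊆ A₂ ω}) :=
        measureReal_mono hcover (measure_ne_top _ _)
    _ ≤ ∑ T ∈ B.powersetCard r, μ.real ({ω | T ⊆ A₁ ω} ∩ {ω | T ⊆ A₂ ω}) :=
        measureReal_biUnion_finset_le _ _
    _ = ∑ T ∈ B.powersetCard r, μ.real {ω | T ⊆ A₁ ω} ^ 2 :=
        Finset.sum_congr rfl fun T _ => hsq T

/-- First inequality of Theorem 1: for i.i.d. estimated active sets `Â⁽¹⁾, Â⁽²⁾`, each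
containing almost surely at most `d` inactive indices, and under the exchangeability
condition at level `r`, the probability that the intersection `Â⁽¹⁾ ∩ Â⁽²⁾` contains at
least `r` inactive indices is at most `(d.choose r)² / ((p - |𝒜|).choose r)`. -/
theorem sis_theorem1_first_inequality {Ω : Type*} [MeasurableSpace Ω] (μ : Measure Ω)
    [IsProbabilityMeasure μ] {p : ℕ} (𝒜 : Finset (Fin p)) (d r : ℕ)
    (hr : r ≤ p - 𝒜.card)
    (A1 A2 : Ω → Finset (Fin p)) (hA1 : Measurable A1) (hA2 : Measurable A2)
    (hindep : IndepFun A1 A2 μ) (hident : Measure.map A1 μ = Measure.map A2 μ)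
    (hcard : ∀ᵐ ω ∂μ, ((A1 ω) ∩ 𝒜ᶜ).card ≤ d)
    (hexch : ∀ T ∈ 𝒜ᶜ.powersetCard r, ∀ T' ∈ 𝒜ᶜ.powersetCard r,
      μ {ω | T ⊆ A1 ω} = μ {ω | T' ⊆ A1 ω}) :
    (μ {ω | r ≤ ((A1 ω) ∩ (A2 ω) ∩ 𝒜ᶜ).card}).toReal
      ≤ (d.choose r : ℝ) ^ 2 / ((p - 𝒜.card).choose r : ℝ) := by
  have hBcard : (𝒜ᶜ.powersetCard r).card = (p - 𝒜.card).choose r := by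
    rw [Finset.card_powersetCard, Finset.card_compl, Fintype.card_fin]
  have hN : 0 < (p - 𝒜.card).choose r := Nat.choose_pos hr
  obtain ⟨T₀, hT₀⟩ := Finset.card_pos.1 (hBcard ▸ hN)
  have hconst : ∀ T ∈ 𝒜ᶜ.powersetCard r, μ.real {ω | T ⊆ A1 ω} = μ.real {ω | T₀ ⊆ A1 ω} :=
    fun T hT => congrArg ENNReal.toReal (hexch T hT T₀ hT₀)
  have hmean := sum_measureReal_subset_le_choose μ 𝒜ᶜ d r hA1 hcard
  have hunion := measureReal_le_card_inter_le_sum_sq μ 𝒜ᶜ r hA1 hA2 hindep hident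
  rw [Finset.sum_congr rfl hconst, Finset.sum_const, hBcard, nsmul_eq_mul] at hmean
  rw [Finset.sum_congr rfl fun T hT => congrArg (· ^ 2) (hconst T hT), Finset.sum_const, hBcard,
    nsmul_eq_mul] at hunion
  rw [le_div_iff₀ (Nat.cast_pos.2 hN)]
  calc _ ≤ ((p - 𝒜.card).choose r * μ.real {ω | T₀ ⊆ A1 ω} ^ 2) * ((p - 𝒜.card).choose r : ℝ) :=
        mul_le_mul_of_nonneg_right hunion (Nat.cast_nonneg _)
    _ = ((p - 𝒜.card).choose r * μ.real {ω | T₀ ⊆ A1 ω}) ^ 2 := by ring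
    _ ≤ (d.choose r : ℝ) ^ 2 := by gcongr
end

section
/- Let d, r, p* ∈ ℕ with d² ≤ p*. Then, as real numbers, (d.choose r)² / (p*.choose r) ≤ (1 / r !) · (d² / p*)^r. -/
theorem sub_sq_mul_le_sq_mul_sub {d q : ℕ} (hdq : d ^ 2 ≤ q) (i : ℕ) :
    (d - i) ^ 2 * q ≤ d ^ 2 * (q - i) := by
  rcases le_total d i with h | h
  · simp [Nat.sub_eq_zero_of_le h]
  · have hiq : i ≤ q := h.trans ((Nat.le_self_pow two_ne_zero d).trans hdq)
    have h₁ : d ^ 2 * i ≤ d * i * q := by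
      calc d ^ 2 * i ≤ q * (d * i) := by
            rcases Nat.eq_zero_or_pos d with rfl | hd
            · simp
            · exact Nat.mul_le_mul hdq (Nat.le_mul_of_pos_left i hd)
        _ = d * i * q := by ring
    have h₂ : i * i * q ≤ d * i * q := by gcongr
    zify [h, hiq] at h₁ h₂ ⊢
    linarith

theorem descFactorial_sq_mul_pow_le {d q : ℕ} (hdq : d ^ 2 ≤ q) (r : ℕ) :
    d.descFactorial r ^ 2 * q ^ r ≤ (d ^ 2) ^ r * q.descFactorial r := by
  induction r with
  | zero => simp
  | succ r ih =>
    rw [Nat.descFactorial_succ, Nat.descFactorial_succ]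
    calc ((d - r) * d.descFactorial r) ^ 2 * q ^ (r + 1)
        = ((d - r) ^ 2 * q) * (d.descFactorial r ^ 2 * q ^ r) := by ring
      _ ≤ (d ^ 2 * (q - r)) * ((d ^ 2) ^ r * q.descFactorial r) :=
          Nat.mul_le_mul (sub_sq_mul_le_sq_mul_sub hdq r) ih
      _ = (d ^ 2) ^ (r + 1) * ((q - r) * q.descFactorial r) := by ring

/-- Second inequality of Theorem 1 in combinatorial form: if `d² ≤ p*`, then
`(d.choose r)² / (p*.choose r) ≤ (1 / r!) (d² / p*) ^ r`. -/
theorem choose_ratio_bound (d r q : ℕ) (hdq : d ^ 2 ≤ q) :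
    (d.choose r : ℝ) ^ 2 / (q.choose r : ℝ)
      ≤ (1 / (r.factorial : ℝ)) * ((d : ℝ) ^ 2 / (q : ℝ)) ^ r := by
  rcases lt_or_ge q r with hr | hr
  · rw [Nat.choose_eq_zero_of_lt hr, Nat.cast_zero, div_zero]
    positivity
  have hf : (0 : ℝ) < r.factorial := by exact_mod_cast r.factorial_pos
  have hc : (0 : ℝ) < q.choose r := by exact_mod_cast Nat.choose_pos hr
  have hq : (0 : ℝ) < (q : ℝ) ^ r := by
    rcases Nat.eq_zero_or_pos q with rfl | hq
    · simp [Nat.le_zero.mp hr]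
    · positivity
  have key := descFactorial_sq_mul_pow_le hdq r
  rw [Nat.descFactorial_eq_factorial_mul_choose,
    Nat.descFactorial_eq_factorial_mul_choose] at key
  have key' : ((r.factorial : ℝ) * d.choose r) ^ 2 * (q : ℝ) ^ r
      ≤ ((d : ℝ) ^ 2) ^ r * (r.factorial * q.choose r) := by exact_mod_cast key
  rw [div_pow, div_mul_div_comm, one_mul, div_le_div_iff₀ hc (mul_pos hf hq)]
  refine le_of_mul_le_mul_left ?_ hf
  linarith
end
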